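/- Let 𝒴 = ℝ^d × 𝕋^d and ρ⁰(p,r) = ρ^OU(p)ρ₀(r) as above, with h(r) = b(r) - ∇_r log ρ₀(r). Suppose δ : 𝒴 → ℝ is a smooth function satisfying the stationary equation ℒ^m δ = (2/√m) ℬδ - (1/√m) p·h(r)(δ + 1), where ℒ^m f = (1/m)(-p·∇_p f + Δ_p f) + (1/√m) ℬf and ℬf = p·∇_r f + b(r)·∇_p f, and suppose δ and its derivatives are square-integrable against ρ⁰. Then ‖∇_p δ‖²_{L²(𝒴;ρ⁰)} = (√m/2) ⟨h(r)·p, δ²⟩_{L²(𝒴;ρ⁰)} + √m ⟨h(r)·p, δ⟩_{L²(𝒴;ρ⁰)}. -/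

import Mathlib

open MeasureTheory Real Filter

noncomputable section

/-- The standard Gaussian (Ornstein–Uhlenbeck invariant) density on ℝ^d. -/
def gaussDensity (d : ℕ) (p : Fin d → ℝ) : ℝ :=
  (2 * π) ^ (-(d : ℝ) / 2) * Real.exp (-(∑ i, p i ^ 2) / 2)

/-- Partial derivative in the i-th p-coordinate. -/
def pd (d : ℕ) (i : Fin d) (f : (Fin d → ℝ) × (Fin d → ℝ) → ℝ) :
    (Fin d → ℝ) × (Fin d → ℝ) → ℝ :=
  fun x => fderiv ℝ (fun p => f (p, x.2)) x.1 (Pi.single i 1)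

/-- Partial derivative in the i-th r-coordinate. -/
def rd (d : ℕ) (i : Fin d) (f : (Fin d → ℝ) × (Fin d → ℝ) → ℝ) :
    (Fin d → ℝ) × (Fin d → ℝ) → ℝ :=
  fun x => fderiv ℝ (fun r => f (x.1, r)) x.2 (Pi.single i 1)

/-- Reference measure on 𝒴 = ℝ^d × 𝕋^d : Lebesgue on ℝ^d times Lebesgue on a
fundamental domain (unit cube) of the torus. -/
def refMeas (d : ℕ) : Measure ((Fin d → ℝ) × (Fin d → ℝ)) :=
  (volume : Measure (Fin d → ℝ)).prod
    ((volume : Measure (Fin d → ℝ)).restrict (Set.Icc 0 1))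

/-- Product reference density ρ⁰(p,r) = ρ^OU(p) ρ₀(r). -/
def rho0 (d : ℕ) (ρ₀ : (Fin d → ℝ) → ℝ) (x : (Fin d → ℝ) × (Fin d → ℝ)) : ℝ :=
  gaussDensity d x.1 * ρ₀ x.2

/-- Integral against the weight ρ⁰ on 𝒴. -/
def wInt (d : ℕ) (ρ₀ : (Fin d → ℝ) → ℝ) (F : (Fin d → ℝ) × (Fin d → ℝ) → ℝ) : ℝ :=
  ∫ x, F x * rho0 d ρ₀ x ∂refMeas d

/-- ℤ^d-periodicity in the r-variable (i.e. f is a function on ℝ^d × 𝕋^d). -/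
def PeriodicR (d : ℕ) (f : (Fin d → ℝ) × (Fin d → ℝ) → ℝ) : Prop :=
  ∀ x : (Fin d → ℝ) × (Fin d → ℝ), ∀ i : Fin d, f (x.1, x.2 + Pi.single i 1) = f x

/-- The transport operator ℬ f = p·∇_r f + b(r)·∇_p f. -/
def Bop (d : ℕ) (b : (Fin d → ℝ) → Fin d → ℝ)
    (f : (Fin d → ℝ) × (Fin d → ℝ) → ℝ) : (Fin d → ℝ) × (Fin d → ℝ) → ℝ :=
  fun x => (∑ i, x.1 i * rd d i f x) + ∑ i, b x.2 i * pd d i f x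

/-- The kinetic (hypoelliptic) operator
ℒ^m f = (1/m)(-p·∇_p f + Δ_p f) + (1/√m) ℬ f. -/
def Lkin (d : ℕ) (m : ℝ) (b : (Fin d → ℝ) → Fin d → ℝ)
    (f : (Fin d → ℝ) × (Fin d → ℝ) → ℝ) : (Fin d → ℝ) × (Fin d → ℝ) → ℝ :=
  fun x => (1 / m) * ((- ∑ i, x.1 i * pd d i f x) + ∑ i, pd d i (pd d i f) x)
    + (1 / Real.sqrt m) * Bop d b f x

/-- The function h(r) = b(r) - ∇_r log ρ₀(r), componentwise. -/
def hfun (d : ℕ) (b : (Fin d → ℝ) → Fin d → ℝ) (ρ₀ : (Fin d → ℝ) → ℝ)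
    (r : Fin d → ℝ) (i : Fin d) : ℝ :=
  b r i - fderiv ℝ ρ₀ r (Pi.single i 1) / ρ₀ r


lemma pd_eq (d : ℕ) (i : Fin d) {f : (Fin d → ℝ) × (Fin d → ℝ) → ℝ} (hf : Differentiable ℝ f)
    (x : (Fin d → ℝ) × (Fin d → ℝ)) : pd d i f x = fderiv ℝ f x (Pi.single i 1, 0) := by
  have h : HasFDerivAt (fun p => f (p, x.2))
      ((fderiv ℝ f x).comp (ContinuousLinearMap.inl ℝ (Fin d → ℝ) (Fin d → ℝ))) x.1 :=
    HasFDerivAt.comp x.1 (g := f) (f := fun p => (p, x.2)) (hf x).hasFDerivAt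
      (hasFDerivAt_prodMk_left x.1 x.2)
  rw [pd, h.fderiv]
  simp

lemma rd_eq (d : ℕ) (i : Fin d) {f : (Fin d → ℝ) × (Fin d → ℝ) → ℝ} (hf : Differentiable ℝ f)
    (x : (Fin d → ℝ) × (Fin d → ℝ)) : rd d i f x = fderiv ℝ f x (0, Pi.single i 1) := by
  have h : HasFDerivAt (fun p => f (x.1, p))
      ((fderiv ℝ f x).comp (ContinuousLinearMap.inr ℝ (Fin d → ℝ) (Fin d → ℝ))) x.2 :=
    HasFDerivAt.comp x.2 (g := f) (f := fun p => (x.1, p)) (hf x).hasFDerivAt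
      (hasFDerivAt_prodMk_right x.1 x.2)
  rw [rd, h.fderiv]
  simp

lemma pd_cont (d : ℕ) (i : Fin d) {f : (Fin d → ℝ) × (Fin d → ℝ) → ℝ} (hf : ContDiff ℝ 1 f) :
    Continuous (pd d i f) := by
  have : pd d i f = fun x => fderiv ℝ f x (Pi.single i 1, 0) :=
    funext fun x => pd_eq d i (hf.differentiable one_ne_zero) x
  rw [this]
  exact (hf.continuous_fderiv one_ne_zero).clm_apply continuous_const

lemma rd_cont (d : ℕ) (i : Fin d) {f : (Fin d → ℝ) × (Fin d → ℝ) → ℝ} (hf : ContDiff ℝ 1 f) :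
    Continuous (rd d i f) := by
  have : rd d i f = fun x => fderiv ℝ f x (0, Pi.single i 1) :=
    funext fun x => rd_eq d i (hf.differentiable one_ne_zero) x
  rw [this]
  exact (hf.continuous_fderiv one_ne_zero).clm_apply continuous_const

/-- Divergence theorem on the torus. -/
lemma torus_div (d : ℕ) (g : Fin d → (Fin d → ℝ) → ℝ) (hg : ∀ i, ContDiff ℝ 1 (g i))
    (hper : ∀ i r, g i (r + Pi.single i 1) = g i r) :
    ∫ r in Set.Icc (0 : Fin d → ℝ) 1, ∑ i, fderiv ℝ (g i) r (Pi.single i 1) = 0 := by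
  cases d with
  | zero => simp
  | succ n =>
    rw [integral_divergence_of_hasFDerivAt_off_countable' (0 : Fin (n+1) → ℝ) 1 zero_le_one g
      (fun i => fderiv ℝ (g i)) ∅ Set.countable_empty
      (fun i => (hg i).continuous.continuousOn)
      (fun x _ i => ((hg i).differentiable one_ne_zero x).hasFDerivAt)]
    · refine Finset.sum_eq_zero fun i _ => ?_
      rw [sub_eq_zero]
      refine integral_congr_ae (Eventually.of_forall fun y => ?_)
      simp only
      rw [← hper i (i.insertNth ((0 : Fin (n+1) → ℝ) i) y)]
      congr 1
      ext j
      refine Fin.succAboveCases i ?_ (fun k => ?_) j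
      · simp
      · simp
    · refine Continuous.integrableOn_Icc ?_
      exact continuous_finsetSum _ fun i _ =>
        ((hg i).continuous_fderiv one_ne_zero).clm_apply continuous_const

lemma cutoff_integrable (d : ℕ) (χ : (Fin d → ℝ) → ℝ) (hχ : Continuous χ)
    (hχs : HasCompactSupport χ) (F : (Fin d → ℝ) × (Fin d → ℝ) → ℝ) (hF : Continuous F) :
    Integrable (fun x => χ x.1 * F x) (refMeas d) := by
  have hm : refMeas d = ((volume : Measure (Fin d → ℝ)).prod
      (volume : Measure (Fin d → ℝ))).restrict (Set.univ ×ˢ Set.Icc 0 1) := by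
    rw [← Measure.prod_restrict, Measure.restrict_univ, refMeas]
  have hc : IsCompact (tsupport χ ×ˢ Set.Icc (0 : Fin d → ℝ) 1) := hχs.isCompact.prod isCompact_Icc
  have hcont : Continuous (fun x : (Fin d → ℝ) × (Fin d → ℝ) => χ x.1 * F x) :=
    (hχ.comp continuous_fst).mul hF
  have h1 : IntegrableOn (fun x => χ x.1 * F x) (tsupport χ ×ˢ Set.Icc (0 : Fin d → ℝ) 1)
      ((volume : Measure (Fin d → ℝ)).prod (volume : Measure (Fin d → ℝ))) :=
    hcont.continuousOn.integrableOn_compact hc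
  rw [hm]
  refine IntegrableOn.of_forall_sdiff_eq_zero h1
    (MeasurableSet.univ.prod measurableSet_Icc) ?_
  rintro ⟨p, r⟩ ⟨⟨_, h2⟩, h3⟩
  have : p ∉ tsupport χ := fun h => h3 ⟨h, h2⟩
  simp [image_eq_zero_of_notMem_tsupport this]

lemma cutoff_div (d : ℕ) (χ : (Fin d → ℝ) → ℝ) (hχ : ContDiff ℝ 1 χ)
    (hχs : HasCompactSupport χ) (F G : Fin d → (Fin d → ℝ) × (Fin d → ℝ) → ℝ)
    (hF : ∀ i, ContDiff ℝ 1 (F i)) (hG : ∀ i, ContDiff ℝ 1 (G i))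
    (hper : ∀ i p r, G i (p, r + Pi.single i 1) = G i (p, r)) :
    ∫ x, χ x.1 * ((∑ i, pd d i (F i) x) + ∑ i, rd d i (G i) x) ∂refMeas d
      = - ∑ i, ∫ x, fderiv ℝ χ x.1 (Pi.single i 1) * F i x ∂refMeas d := by
  have hχd : ∀ i : Fin d, Continuous (fun p => fderiv ℝ χ p (Pi.single i 1)) := fun i =>
    (hχ.continuous_fderiv one_ne_zero).clm_apply continuous_const
  have hχds : ∀ i : Fin d, HasCompactSupport (fun p => fderiv ℝ χ p (Pi.single i 1)) := fun i =>
    hχs.fderiv_apply ℝ _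
  have hI1 : ∀ i, Integrable (fun x => χ x.1 * pd d i (F i) x) (refMeas d) := fun i =>
    cutoff_integrable d χ hχ.continuous hχs _ (pd_cont d i (hF i))
  have hI2 : Integrable (fun x => χ x.1 * ∑ i, rd d i (G i) x) (refMeas d) :=
    cutoff_integrable d χ hχ.continuous hχs _
      (continuous_finsetSum _ fun i _ => rd_cont d i (hG i))
  have hI3 : ∀ i, Integrable (fun x => fderiv ℝ χ x.1 (Pi.single i 1) * F i x) (refMeas d) :=
    fun i => cutoff_integrable d _ (hχd i) (hχds i) _ (hF i).continuous
  have e2 : ∫ x, χ x.1 * ∑ i, rd d i (G i) x ∂refMeas d = 0 := by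
    rw [refMeas] at hI2 ⊢
    rw [integral_prod _ hI2]
    refine integral_eq_zero_of_ae (Eventually.of_forall fun p => ?_)
    simp only [rd, Pi.zero_apply]
    rw [integral_const_mul, torus_div d (fun i r => G i (p, r))
      (fun i => (hG i).comp (contDiff_const.prodMk contDiff_id)) (fun i r => hper i p r), mul_zero]
  have e1 : ∀ i, ∫ x, χ x.1 * pd d i (F i) x ∂refMeas d
      = - ∫ x, fderiv ℝ χ x.1 (Pi.single i 1) * F i x ∂refMeas d := by
    intro i
    have h1 := hI1 i
    have h3 := hI3 i
    rw [refMeas] at h1 h3 ⊢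
    rw [integral_prod_symm _ h1, integral_prod_symm _ h3, ← integral_neg]
    refine integral_congr_ae (Eventually.of_forall fun r => ?_)
    have hFr : ContDiff ℝ 1 (fun p => F i (p, r)) :=
      (hF i).comp (contDiff_id.prodMk contDiff_const)
    simp only [pd]
    refine integral_mul_fderiv_eq_neg_fderiv_mul_of_integrable ?_ ?_ ?_
      (fun x _ => hχ.differentiable one_ne_zero x) (fun x _ => hFr.differentiable one_ne_zero x)
    · exact ((hχd i).mul hFr.continuous).integrable_of_hasCompactSupport (hχds i).mul_right
    · exact (hχ.continuous.mul ((hFr.continuous_fderiv one_ne_zero).clm_apply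
        continuous_const)).integrable_of_hasCompactSupport hχs.mul_right
    · exact (hχ.continuous.mul hFr.continuous).integrable_of_hasCompactSupport hχs.mul_right
  simp only [mul_add, Finset.mul_sum] at hI2 e2 ⊢
  rw [integral_add (integrable_finsetSum _ fun i _ => hI1 i) hI2, e2, add_zero,
    integral_finsetSum _ (fun i _ => hI1 i), ← Finset.sum_neg_distrib]
  exact Finset.sum_congr rfl fun i _ => e1 i

lemma div_zero_integral (d : ℕ) (F G : Fin d → (Fin d → ℝ) × (Fin d → ℝ) → ℝ)
    (hF : ∀ i, ContDiff ℝ 1 (F i)) (hG : ∀ i, ContDiff ℝ 1 (G i))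
    (hper : ∀ i p r, G i (p, r + Pi.single i 1) = G i (p, r))
    (hFi : ∀ i, Integrable (F i) (refMeas d))
    (hD : Integrable (fun x => (∑ i, pd d i (F i) x) + ∑ i, rd d i (G i) x) (refMeas d)) :
    ∫ x, ((∑ i, pd d i (F i) x) + ∑ i, rd d i (G i) x) ∂refMeas d = 0 := by
  let φ : ContDiffBump (0 : Fin d → ℝ) := ⟨1, 2, one_pos, one_lt_two⟩
  have hφ : ContDiff ℝ 1 φ := φ.contDiff
  have hφs : HasCompactSupport φ := φ.hasCompactSupport
  let c : ℕ → ℝ := fun n => 1 / ((n : ℝ) + 1)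
  have hc0 : ∀ n, c n ≠ 0 := fun n => by positivity
  have hcpos : ∀ n, 0 < c n := fun n => by positivity
  have hc1 : ∀ n, c n ≤ 1 := fun n => by
    simp only [c]
    rw [div_le_one (by positivity)]
    have : (0 : ℝ) ≤ n := by positivity
    linarith
  have hct : Tendsto c atTop (nhds 0) := tendsto_one_div_add_atTop_nhds_zero_nat
  let χ : ℕ → (Fin d → ℝ) → ℝ := fun n p => φ (c n • p)
  have hχ : ∀ n, ContDiff ℝ 1 (χ n) := fun n => hφ.comp (contDiff_const_smul (c n))
  have hχs : ∀ n, HasCompactSupport (χ n) := fun n => hφs.comp_smul (hc0 n)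
  have hfd : ∀ n p v, fderiv ℝ (χ n) p v = c n * fderiv ℝ φ (c n • p) v := by
    intro n p v
    have := fderiv_comp_smul (𝕜 := ℝ) (f := φ) (c := c n) (x := p)
    simp only [χ]
    rw [this]
    simp
  have hsmul : ∀ p : Fin d → ℝ, Tendsto (fun n => c n • p) atTop (nhds 0) := fun p => by
    simpa using hct.smul_const p
  have key := fun n => cutoff_div d (χ n) (hχ n) (hχs n) F G hF hG hper
  have L : Tendsto (fun n => ∫ x, χ n x.1 *
      ((∑ i, pd d i (F i) x) + ∑ i, rd d i (G i) x) ∂refMeas d) atTop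
      (nhds (∫ x, ((∑ i, pd d i (F i) x) + ∑ i, rd d i (G i) x) ∂refMeas d)) := by
    refine tendsto_integral_of_dominated_convergence _ (fun n => ?_) hD.norm (fun n => ?_) ?_
    · exact (((hχ n).continuous.comp continuous_fst).aestronglyMeasurable).mul
        hD.aestronglyMeasurable
    · refine Eventually.of_forall fun x => ?_
      rw [norm_mul]
      refine mul_le_of_le_one_left (norm_nonneg _) ?_
      rw [Real.norm_of_nonneg φ.nonneg]
      exact φ.le_one
    · refine Eventually.of_forall fun x => ?_
      have h1 : Tendsto (fun n => χ n x.1) atTop (nhds 1) := by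
        have := (φ.continuous.tendsto 0).comp (hsmul x.1)
        have h0 : φ 0 = 1 := φ.one_of_mem_closedBall (by simp [φ.rIn_pos.le])
        rw [h0] at this
        exact this
      simpa using h1.mul_const ((∑ i, pd d i (F i) x) + ∑ i, rd d i (G i) x)
  have R : Tendsto (fun n => - ∑ i, ∫ x, fderiv ℝ (χ n) x.1 (Pi.single i 1) * F i x ∂refMeas d)
      atTop (nhds 0) := by
    rw [← neg_zero, ← Finset.sum_const_zero (s := (Finset.univ : Finset (Fin d)))]
    refine (tendsto_finsetSum _ fun i _ => ?_).neg
    have hcf : Continuous (fun p => fderiv ℝ φ p (Pi.single i 1)) :=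
      (hφ.continuous_fderiv one_ne_zero).clm_apply continuous_const
    obtain ⟨C, hC⟩ := hcf.bounded_above_of_compact_support (hφs.fderiv_apply ℝ _)
    have : ∀ n, ∫ x, fderiv ℝ (χ n) x.1 (Pi.single i 1) * F i x ∂refMeas d
        = c n * ∫ x, fderiv ℝ φ (c n • x.1) (Pi.single i 1) * F i x ∂refMeas d := by
      intro n
      rw [← integral_const_mul]
      simp only [hfd, mul_assoc]
    simp only [this]
    refine squeeze_zero_norm (a := fun n => c n * (C * ∫ x, ‖F i x‖ ∂refMeas d)) (fun n => ?_)
      (by simpa using hct.mul_const (C * ∫ x, ‖F i x‖ ∂refMeas d))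
    rw [norm_mul, Real.norm_of_nonneg (hcpos n).le]
    refine mul_le_mul_of_nonneg_left ?_ (hcpos n).le
    rw [← integral_const_mul]
    refine norm_integral_le_of_norm_le ((hFi i).norm.const_mul C)
      (Eventually.of_forall fun x => ?_)
    rw [norm_mul]
    exact mul_le_mul_of_nonneg_right (hC _) (norm_nonneg _)
  simp only [key] at L
  exact tendsto_nhds_unique L R

lemma pd_mul (d : ℕ) (i : Fin d) {f g : (Fin d → ℝ) × (Fin d → ℝ) → ℝ}
    (hf : Differentiable ℝ f) (hg : Differentiable ℝ g) (x : (Fin d → ℝ) × (Fin d → ℝ)) :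
    pd d i (fun x => f x * g x) x = pd d i f x * g x + f x * pd d i g x := by
  rw [pd_eq d i (hf.fun_mul hg), pd_eq d i hf, pd_eq d i hg, fderiv_fun_mul (hf x) (hg x)]
  simp
  ring

lemma rd_mul (d : ℕ) (i : Fin d) {f g : (Fin d → ℝ) × (Fin d → ℝ) → ℝ}
    (hf : Differentiable ℝ f) (hg : Differentiable ℝ g) (x : (Fin d → ℝ) × (Fin d → ℝ)) :
    rd d i (fun x => f x * g x) x = rd d i f x * g x + f x * rd d i g x := by
  rw [rd_eq d i (hf.fun_mul hg), rd_eq d i hf, rd_eq d i hg, fderiv_fun_mul (hf x) (hg x)]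
  simp
  ring

lemma pd_sub (d : ℕ) (i : Fin d) {f g : (Fin d → ℝ) × (Fin d → ℝ) → ℝ}
    (hf : Differentiable ℝ f) (hg : Differentiable ℝ g) (x : (Fin d → ℝ) × (Fin d → ℝ)) :
    pd d i (fun x => f x - g x) x = pd d i f x - pd d i g x := by
  rw [pd_eq d i (hf.fun_sub hg), pd_eq d i hf, pd_eq d i hg, fderiv_fun_sub (hf x) (hg x)]
  simp

lemma pd_of_snd (d : ℕ) (i : Fin d) (f : (Fin d → ℝ) → ℝ) (x : (Fin d → ℝ) × (Fin d → ℝ)) :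
    pd d i (fun x => f x.2) x = 0 := by
  simp [pd]

lemma rd_of_fst (d : ℕ) (i : Fin d) (f : (Fin d → ℝ) → ℝ) (x : (Fin d → ℝ) × (Fin d → ℝ)) :
    rd d i (fun x => f x.1) x = 0 := by
  simp [rd]

lemma gauss_contDiff (d : ℕ) : ContDiff ℝ (⊤ : ℕ∞) (gaussDensity d) := by
  unfold gaussDensity
  fun_prop

lemma gauss_pos (d : ℕ) (p : Fin d → ℝ) : 0 < gaussDensity d p := by
  unfold gaussDensity
  positivity

lemma gauss_fderiv (d : ℕ) (i : Fin d) (p : Fin d → ℝ) :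
    fderiv ℝ (gaussDensity d) p (Pi.single i 1) = - p i * gaussDensity d p := by
  have h1 : ∀ j : Fin d, HasFDerivAt (fun p : Fin d → ℝ => p j)
      (ContinuousLinearMap.proj (R := ℝ) (φ := fun _ : Fin d => ℝ) j) p := fun j =>
    (ContinuousLinearMap.proj (R := ℝ) (φ := fun _ : Fin d => ℝ) j).hasFDerivAt
  have h2 := HasFDerivAt.fun_sum (u := Finset.univ) (fun j _ => (h1 j).pow 2)
  have h3 := ((h2.neg.mul_const (2 : ℝ)⁻¹).exp).const_mul ((2 * π) ^ (-(d : ℝ) / 2))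
  have h4 : HasFDerivAt (gaussDensity d) _ p := h3
  rw [h4.fderiv]
  simp [gaussDensity, Pi.single_apply, div_eq_mul_inv]
  ring

lemma rho0_pd (d : ℕ) (i : Fin d) (ρ₀ : (Fin d → ℝ) → ℝ) (hρ : ContDiff ℝ (⊤ : ℕ∞) ρ₀)
    (x : (Fin d → ℝ) × (Fin d → ℝ)) :
    pd d i (rho0 d ρ₀) x = - x.1 i * rho0 d ρ₀ x := by
  have hg : Differentiable ℝ (fun x : (Fin d → ℝ) × (Fin d → ℝ) => gaussDensity d x.1) :=
    ((gauss_contDiff d).differentiable (by simp)).comp differentiable_fst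
  have hr : Differentiable ℝ (fun x : (Fin d → ℝ) × (Fin d → ℝ) => ρ₀ x.2) :=
    (hρ.differentiable (by simp)).comp differentiable_snd
  have := pd_mul d i hg hr x
  rw [pd_of_snd] at this
  have h2 : pd d i (fun x => gaussDensity d x.1) x = - x.1 i * gaussDensity d x.1 :=
    gauss_fderiv d i x.1
  rw [h2] at this
  change pd d i (fun x => gaussDensity d x.1 * ρ₀ x.2) x = _
  rw [this, rho0]
  ring

lemma rho0_rd (d : ℕ) (i : Fin d) (ρ₀ : (Fin d → ℝ) → ℝ) (hρ : ContDiff ℝ (⊤ : ℕ∞) ρ₀)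
    (hpos : ∀ r, 0 < ρ₀ r) (x : (Fin d → ℝ) × (Fin d → ℝ)) :
    rd d i (rho0 d ρ₀) x = fderiv ℝ ρ₀ x.2 (Pi.single i 1) / ρ₀ x.2 * rho0 d ρ₀ x := by
  have hg : Differentiable ℝ (fun x : (Fin d → ℝ) × (Fin d → ℝ) => gaussDensity d x.1) :=
    ((gauss_contDiff d).differentiable (by simp)).comp differentiable_fst
  have hr : Differentiable ℝ (fun x : (Fin d → ℝ) × (Fin d → ℝ) => ρ₀ x.2) :=
    (hρ.differentiable (by simp)).comp differentiable_snd
  have := rd_mul d i hg hr x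
  rw [rd_of_fst] at this
  have h2 : rd d i (fun x => ρ₀ x.2) x = fderiv ℝ ρ₀ x.2 (Pi.single i 1) := rfl
  rw [h2] at this
  change rd d i (fun x => gaussDensity d x.1 * ρ₀ x.2) x = _
  rw [this, rho0]
  have := (hpos x.2).ne'
  field_simp
  ring

/-- Lemma 6.4 of the paper: the energy identity for the relative deviation δ
of the invariant density, obtained by testing the stationary equation
ℒ^m δ = (2/√m) ℬδ - (1/√m) p·h(r)(δ + 1) against δ. -/
theorem deviation_energy_identity (d : ℕ) (m : ℝ) (hm : 0 < m)
    (ρ₀ : (Fin d → ℝ) → ℝ) (b : (Fin d → ℝ) → Fin d → ℝ)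
    (hρsm : ContDiff ℝ (⊤ : ℕ∞) ρ₀) (hρpos : ∀ r, 0 < ρ₀ r)
    (hρprob : ∫ r in Set.Icc (0 : Fin d → ℝ) 1, ρ₀ r = 1)
    (hρper : ∀ r : Fin d → ℝ, ∀ i : Fin d, ρ₀ (r + Pi.single i 1) = ρ₀ r)
    (hb : ContDiff ℝ (⊤ : ℕ∞) b)
    (hbper : ∀ r : Fin d → ℝ, ∀ i j : Fin d, b (r + Pi.single i 1) j = b r j)
    (δ : (Fin d → ℝ) × (Fin d → ℝ) → ℝ)
    (hδ : ContDiff ℝ (⊤ : ℕ∞) δ) (hδper : PeriodicR d δ)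
    -- the stationary equation for δ
    (heq : ∀ x, Lkin d m b δ x
      = (2 / Real.sqrt m) * Bop d b δ x
        - (1 / Real.sqrt m) * (∑ i, x.1 i * hfun d b ρ₀ x.2 i) * (δ x + 1))
    -- δ and its derivatives square-integrable against ρ⁰
    (hδ2 : Integrable (fun x => δ x ^ 2 * rho0 d ρ₀ x) (refMeas d))
    (hdpδ2 : Integrable (fun x => (∑ i, pd d i δ x ^ 2) * rho0 d ρ₀ x) (refMeas d))
    (hdrδ2 : Integrable (fun x => (∑ i, rd d i δ x ^ 2) * rho0 d ρ₀ x) (refMeas d))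
    (hdppδ2 : Integrable (fun x =>
      (∑ i, ∑ j, pd d i (pd d j δ) x ^ 2) * rho0 d ρ₀ x) (refMeas d))
    (hint1 : Integrable (fun x =>
      (∑ i, x.1 i * hfun d b ρ₀ x.2 i) * δ x ^ 2 * rho0 d ρ₀ x) (refMeas d))
    (hint2 : Integrable (fun x =>
      (∑ i, x.1 i * hfun d b ρ₀ x.2 i) * δ x * rho0 d ρ₀ x) (refMeas d))
    (hint3 : Integrable (fun x => δ x * Bop d b δ x * rho0 d ρ₀ x) (refMeas d))
    (hint4 : Integrable (fun x => δ x * Lkin d m b δ x * rho0 d ρ₀ x) (refMeas d)) :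
    wInt d ρ₀ (fun x => ∑ i, pd d i δ x ^ 2)
      = (Real.sqrt m / 2) *
          wInt d ρ₀ (fun x => (∑ i, x.1 i * hfun d b ρ₀ x.2 i) * δ x ^ 2)
        + Real.sqrt m *
            wInt d ρ₀ (fun x => (∑ i, x.1 i * hfun d b ρ₀ x.2 i) * δ x) := by
  have hδd : Differentiable ℝ δ := hδ.differentiable (by simp)
  have hw : ContDiff ℝ (⊤ : ℕ∞) (rho0 d ρ₀) :=
    ((gauss_contDiff d).comp contDiff_fst).mul (hρsm.comp contDiff_snd)
  have hwd : Differentiable ℝ (rho0 d ρ₀) := hw.differentiable (by simp)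
  have hwpos : ∀ x, 0 < rho0 d ρ₀ x := fun x => mul_pos (gauss_pos d _) (hρpos _)
  have hq : ∀ i, ContDiff ℝ 1 (pd d i δ) := by
    intro i
    have : pd d i δ = fun x => fderiv ℝ δ x (Pi.single i 1, 0) := funext fun x => pd_eq d i hδd x
    rw [this]
    exact ((hδ.fderiv_right (m := (⊤ : ℕ∞)) (by exact_mod_cast le_top)).of_le
      (by exact_mod_cast le_top)).clm_apply contDiff_const
  have hqd : ∀ i, Differentiable ℝ (pd d i δ) := fun i => (hq i).differentiable one_ne_zero
  have hbi : ∀ i, ContDiff ℝ 1 (fun x : (Fin d → ℝ) × (Fin d → ℝ) => b x.2 i) := fun i =>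
    (((contDiff_pi.1 hb) i).comp contDiff_snd).of_le (by exact_mod_cast le_top)
  have hbd : ∀ i, Differentiable ℝ (fun x : (Fin d → ℝ) × (Fin d → ℝ) => b x.2 i) :=
    fun i => (hbi i).differentiable one_ne_zero
  have hδ1 : ContDiff ℝ 1 δ := hδ.of_le (by exact_mod_cast le_top)
  have hw1 : ContDiff ℝ 1 (rho0 d ρ₀) := hw.of_le (by exact_mod_cast le_top)
  have hp1 : ∀ i, ContDiff ℝ 1 (fun x : (Fin d → ℝ) × (Fin d → ℝ) => x.1 i) := fun i => by
    fun_prop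
  have hpD : ∀ i, Differentiable ℝ (fun x : (Fin d → ℝ) × (Fin d → ℝ) => x.1 i) :=
    fun i => (hp1 i).differentiable one_ne_zero
  have hs : 0 < Real.sqrt m := Real.sqrt_pos.2 hm
  obtain ⟨k, hk⟩ : ∃ k : ℝ, k = 1 / (2 * Real.sqrt m) := ⟨_, rfl⟩
  have hk1 : 1 / Real.sqrt m = 2 * k := by rw [hk]; field_simp
  have hk2 : 2 / Real.sqrt m = 4 * k := by rw [hk]; field_simp; norm_num
  obtain ⟨a, ha⟩ : ∃ a : ℝ, a = 1 / m := ⟨_, rfl⟩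
  let E : (Fin d → ℝ) × (Fin d → ℝ) → ℝ := fun x => δ x * (δ x * rho0 d ρ₀ x)
  have hE : ContDiff ℝ 1 E := hδ1.mul (hδ1.mul hw1)
  have hEd : Differentiable ℝ E := hE.differentiable one_ne_zero
  let F1 : Fin d → (Fin d → ℝ) × (Fin d → ℝ) → ℝ := fun i x =>
    a * (δ x * (pd d i δ x * rho0 d ρ₀ x))
  let F2 : Fin d → (Fin d → ℝ) × (Fin d → ℝ) → ℝ := fun i x => (k * b x.2 i) * E x
  let F : Fin d → (Fin d → ℝ) × (Fin d → ℝ) → ℝ := fun i x => F1 i x - F2 i x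
  let G : Fin d → (Fin d → ℝ) × (Fin d → ℝ) → ℝ := fun i x => (-k * x.1 i) * E x
  have hF1 : ∀ i, ContDiff ℝ 1 (F1 i) := fun i =>
    contDiff_const.mul (hδ1.mul ((hq i).mul hw1))
  have hkb : ∀ i, ContDiff ℝ 1 (fun x : (Fin d → ℝ) × (Fin d → ℝ) => k * b x.2 i) :=
    fun i => contDiff_const.mul (hbi i)
  have hF2 : ∀ i, ContDiff ℝ 1 (F2 i) := fun i => (hkb i).mul hE
  have hF : ∀ i, ContDiff ℝ 1 (F i) := fun i => (hF1 i).sub (hF2 i)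
  have hkp : ∀ i, ContDiff ℝ 1 (fun x : (Fin d → ℝ) × (Fin d → ℝ) => -k * x.1 i) :=
    fun i => contDiff_const.mul (hp1 i)
  have hG : ∀ i, ContDiff ℝ 1 (G i) := fun i => (hkp i).mul hE
  have hper : ∀ i p r, G i (p, r + Pi.single i 1) = G i (p, r) := by
    intro i p r
    have := hδper (p, r) i
    simp only at this
    simp only [G, E, rho0, this, hρper r i]
  -- derivative computations
  have hpdF : ∀ i x, pd d i (F i) x
      = a * (pd d i δ x ^ 2 * rho0 d ρ₀ x) + a * (pd d i (pd d i δ) x) * (δ x * rho0 d ρ₀ x)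
        - a * (x.1 i * pd d i δ x) * (δ x * rho0 d ρ₀ x)
        - 2 * k * (b x.2 i * pd d i δ x) * (δ x * rho0 d ρ₀ x)
        + k * (x.1 i * b x.2 i) * (δ x ^ 2 * rho0 d ρ₀ x) := by
    intro i x
    have e0 := pd_sub d i ((hF1 i).differentiable one_ne_zero)
      ((hF2 i).differentiable one_ne_zero) x
    have e1 := pd_mul d i (f := fun _ => a) (differentiable_const a)
      (hδd.mul ((hqd i).mul hwd)) x
    have e2 := pd_mul d i hδd ((hqd i).mul hwd) x
    have e3 := pd_mul d i (hqd i) hwd x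
    have e4 := pd_mul d i ((hkb i).differentiable one_ne_zero) hEd x
    have e5 := pd_mul d i hδd (hδd.mul hwd) x
    have e6 := pd_mul d i hδd hwd x
    have e7 := pd_of_snd d i (fun r => k * b r i) x
    have e8 := pd_of_snd d i (fun _ => a) x
    have e9 := rho0_pd d i ρ₀ hρsm x
    have e0' : pd d i (F i) x = pd d i (F1 i) x - pd d i (F2 i) x := e0
    have e1' : pd d i (F1 i) x = _ := e1
    have e4' : pd d i (F2 i) x = _ := e4
    have e5' : pd d i E x = _ := e5
    simp only [Pi.mul_apply, Pi.mul_def] at e1' e2 e5'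
    rw [e0', e1', e4', e7, e8, e5', e6, e2, e3, e9]
    simp only [E]
    ring
  have hrdG : ∀ i x, rd d i (G i) x
      = - (2 * k) * (x.1 i * rd d i δ x) * (δ x * rho0 d ρ₀ x)
        - k * (x.1 i * (fderiv ℝ ρ₀ x.2 (Pi.single i 1) / ρ₀ x.2)) * (δ x ^ 2 * rho0 d ρ₀ x) := by
    intro i x
    have e4 := rd_mul d i ((hkp i).differentiable one_ne_zero) hEd x
    have e5 := rd_mul d i hδd (hδd.mul hwd) x
    have e6 := rd_mul d i hδd hwd x
    have e7 := rd_of_fst d i (fun r => -k * r i) x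
    have e9 := rho0_rd d i ρ₀ hρsm hρpos x
    have e4' : rd d i (G i) x = _ := e4
    have e5' : rd d i E x = _ := e5
    simp only [Pi.mul_apply, Pi.mul_def] at e5'
    rw [e4', e7, e5', e6, e9]
    simp only [E]
    ring
  have hDiv : ∀ x, (∑ i, pd d i (F i) x) + ∑ i, rd d i (G i) x
      = a * ((∑ i, pd d i δ x ^ 2) * rho0 d ρ₀ x)
        - k * ((∑ i, x.1 i * hfun d b ρ₀ x.2 i) * δ x ^ 2 * rho0 d ρ₀ x)
        - 2 * k * ((∑ i, x.1 i * hfun d b ρ₀ x.2 i) * δ x * rho0 d ρ₀ x) := by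
    intro x
    have h := heq x
    simp only [Lkin, Bop, hk1, hk2, ← ha] at h
    have hH : ∑ i, x.1 i * hfun d b ρ₀ x.2 i = (∑ i, x.1 i * b x.2 i)
        - ∑ i, x.1 i * (fderiv ℝ ρ₀ x.2 (Pi.single i 1) / ρ₀ x.2) := by
      simp only [hfun, mul_sub, Finset.sum_sub_distrib]
    simp only [hpdF, hrdG, Finset.sum_add_distrib, Finset.sum_sub_distrib, ← Finset.sum_mul,
      ← Finset.mul_sum]
    rw [hH] at h ⊢
    linear_combination (δ x * rho0 d ρ₀ x) * h
  have hDint : Integrable (fun x => (∑ i, pd d i (F i) x) + ∑ i, rd d i (G i) x) (refMeas d) := by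
    simp only [hDiv]
    exact ((hdpδ2.const_mul a).sub (hint1.const_mul k)).sub (hint2.const_mul (2 * k))
  have hF1i : ∀ i, Integrable (F1 i) (refMeas d) := by
    intro i
    refine Integrable.const_mul ?_ a
    refine (hδ2.add hdpδ2).mono'
      (hδ1.continuous.mul ((hq i).continuous.mul hw1.continuous)).aestronglyMeasurable
      (Eventually.of_forall fun x => ?_)
    have h1 : pd d i δ x ^ 2 ≤ ∑ j, pd d j δ x ^ 2 :=
      Finset.single_le_sum (f := fun j => pd d j δ x ^ 2) (fun j _ => sq_nonneg _)
        (Finset.mem_univ i)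
    have h2 : |δ x * pd d i δ x| ≤ δ x ^ 2 + ∑ j, pd d j δ x ^ 2 := by
      rw [abs_le]
      constructor <;> nlinarith [sq_nonneg (δ x + pd d i δ x), sq_nonneg (δ x - pd d i δ x),
        sq_nonneg (δ x), sq_nonneg (pd d i δ x)]
    simp only [Pi.add_apply]
    rw [← mul_assoc, norm_mul, Real.norm_of_nonneg (hwpos x).le, Real.norm_eq_abs, ← add_mul]
    exact mul_le_mul_of_nonneg_right h2 (hwpos x).le
  have hF2i : ∀ i, Integrable (F2 i) (refMeas d) := by
    intro i
    have hbc : Continuous (fun r => k * b r i) :=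
      continuous_const.mul ((continuous_apply i).comp hb.continuous)
    obtain ⟨C, hC⟩ := (isCompact_Icc (a := (0 : Fin d → ℝ)) (b := 1)).exists_bound_of_continuousOn
      hbc.continuousOn
    have hEi : Integrable E (refMeas d) := by
      refine hδ2.congr (Eventually.of_forall fun x => ?_)
      simp only [E]
      ring
    refine hEi.bdd_mul (c := C) (hkb i).continuous.aestronglyMeasurable ?_
    have hae : ∀ᵐ x ∂refMeas d, x.2 ∈ Set.Icc (0 : Fin d → ℝ) 1 :=
      Measure.quasiMeasurePreserving_snd.ae (ae_restrict_mem measurableSet_Icc)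
    filter_upwards [hae] with x hx using hC _ hx
  have main := div_zero_integral d F G hF hG hper (fun i => (hF1i i).sub (hF2i i)) hDint
  simp only [hDiv] at main
  have hsub := (hdpδ2.const_mul a).sub (hint1.const_mul k)
  simp only [Pi.sub_def] at hsub
  rw [integral_sub hsub (hint2.const_mul (2 * k)),
    integral_sub (hdpδ2.const_mul a) (hint1.const_mul k), integral_const_mul, integral_const_mul,
    integral_const_mul] at main
  simp only [wInt]
  have hma : m * a = 1 := by rw [ha]; field_simp
  have hmk : m * k = Real.sqrt m / 2 := by
    rw [hk]
    nth_rewrite 1 [← Real.mul_self_sqrt hm.le]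
    field_simp
  generalize (∫ x, (∑ i, pd d i δ x ^ 2) * rho0 d ρ₀ x ∂refMeas d) = I1 at main ⊢
  generalize (∫ x, (∑ i, x.1 i * hfun d b ρ₀ x.2 i) * δ x ^ 2 * rho0 d ρ₀ x ∂refMeas d) = I2
    at main ⊢
  generalize (∫ x, (∑ i, x.1 i * hfun d b ρ₀ x.2 i) * δ x * rho0 d ρ₀ x ∂refMeas d) = I3
    at main ⊢
  linear_combination m * main - I1 * hma + (I2 + 2 * I3) * hmk
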